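/- Let f : ℝ² → ℝ be twice continuously differentiable with compact support contained in the ball of radius D > 0 (i.e. f(x) = 0 whenever ‖x‖ ≥ D), and suppose its second-order partial derivatives are globally bounded by C > 0: |∂²f(x)/∂x₁²| ≤ C and |∂²f(x)/∂x₂²| ≤ C for all x ∈ ℝ². Let h > 0 be such that n := 2D/h + 1 is a positive integer, and let x_{ij} = ( (i − (n+1)/2)·h , (j − (n+1)/2)·h ) for (i,j) ∈ Δ = {(i,j) : 1 ≤ i, j ≤ n}. Then the Riemann-sum discretization error satisfies | ∫_{ℝ²} f(x) dx − Σ_{(i,j)∈Δ} f(x_{ij})·h² | ≤ C·D²·h². -/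

import Mathlib

open MeasureTheory

/-- The cell-centered grid point of a regular 2D grid. -/
noncomputable def gridPt (a b : ℝ) : EuclideanSpace ℝ (Fin 2) :=
  (WithLp.equiv 2 (Fin 2 → ℝ)).symm ![a, b]

lemma aux_one (g : ℝ → ℝ) (hg : ContDiff ℝ 2 g) (C D h : ℝ) (hC : 0 < C) (hD : 0 < D) (hh : 0 < h)
    (hb : ∀ x, |iteratedDeriv 2 g x| ≤ C) (h0 : ∀ t, D ≤ |t| → g t = 0)
    (n : ℕ) (hnh : (n : ℝ) = 2 * D / h + 1) :
    |(∫ t, g t) - ∑ i ∈ Finset.Icc 1 n, g (((i : ℝ) - ((n : ℝ) + 1) / 2) * h) * h|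
      ≤ C * D * h ^ 2 / 6 := by
  have hpos : 0 < 2 * D / h := by positivity
  obtain ⟨M, rfl⟩ : ∃ M, n = M + 2 := by
    refine ⟨n - 2, ?_⟩
    have : (1 : ℝ) < n := by linarith
    have : 1 < n := by exact_mod_cast this
    omega
  have hM : ((M : ℝ) + 1) * h = 2 * D := by
    push_cast at hnh
    have : (M : ℝ) + 1 = 2 * D / h := by linarith
    rw [this]; field_simp
  have hMh : 2 * D / ((M : ℝ) + 1) = h := by
    rw [← hM]; field_simp
  have hlt : -D < D := by linarith
  have key := trapezoidal_error_le_of_c2 (f := g) (a := -D) (b := D) hg.contDiffOn (ζ := C)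
    (by
      intro x
      rw [Set.uIcc_of_lt hlt]
      by_cases hx : x ∈ Set.Icc (-D) D
      · rw [iteratedDerivWithin_eq_iteratedDeriv (uniqueDiffOn_Icc hlt) hg.contDiffAt hx]
        exact hb x
      · rw [iteratedDerivWithin_succ, derivWithin_zero_of_notMem_closure
          (by rwa [closure_Icc]), abs_zero]
        exact hC.le) (N := M + 1) (by omega)
  have e1 : |D - -D| ^ 3 * C / (12 * ((M + 1 : ℕ) : ℝ) ^ 2) = C * D * h ^ 2 / 6 := by
    rw [abs_of_pos (by linarith)]
    rw [← hMh]; push_cast; field_simp; ring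
  rw [e1] at key
  have gD : g D = 0 := h0 _ (le_abs_self _)
  have gD' : g (-D) = 0 := h0 _ (by rw [abs_neg]; exact le_abs_self _)
  have e2 : (∫ t, g t) = ∫ t in (-D)..D, g t := by
    rw [intervalIntegral.integral_eq_integral_of_support_subset]
    intro t ht
    by_contra hcon
    apply ht
    apply h0
    rw [Set.mem_Ioc, not_and_or] at hcon
    rcases hcon with hc | hc
    · rw [le_abs]; right; linarith
    · rw [le_abs]; left; linarith
  have e3 : ∑ i ∈ Finset.Icc 1 (M + 2), g (((i : ℝ) - (((M + 2 : ℕ) : ℝ) + 1) / 2) * h) * h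
      = trapezoidal_integral g (M + 1) (-D) D := by
    have e4 : ∀ F : ℕ → ℝ, ∑ i ∈ Finset.Icc 1 (M + 2), F i
        = ∑ i ∈ Finset.range (M + 2), F (i + 1) := by
      intro F
      rw [Finset.range_eq_Ico, Finset.sum_Ico_add' F 0 (M + 2) 1]
      rfl
    have e5 : (M : ℝ) * h = 2 * D - h := by linarith
    rw [e4, Finset.sum_range_succ, Finset.sum_range_succ']
    have z1 : (((0 + 1 : ℕ) : ℝ) - (((M + 2 : ℕ) : ℝ) + 1) / 2) * h = -D := by
      push_cast; linarith
    have z2 : (((M + 1 + 1 : ℕ) : ℝ) - (((M + 2 : ℕ) : ℝ) + 1) / 2) * h = D := by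
      push_cast; linarith
    rw [z1, z2, gD, gD', trapezoidal_integral, gD, gD']
    have z3 : (D - -D) / ((M + 1 : ℕ) : ℝ) = h := by
      rw [← hMh]; push_cast; ring
    rw [z3, mul_add, Finset.mul_sum]
    simp only [zero_mul, add_zero, zero_div, mul_zero, zero_add, Nat.add_sub_cancel]
    refine Finset.sum_congr rfl fun k _ => ?_
    rw [mul_div_assoc, z3, mul_comm h]
    congr 2
    push_cast; linarith
  rw [e2, e3, abs_sub_comm]
  exact key

lemma gridPt_eq (a b : ℝ) : gridPt a b =
    a • EuclideanSpace.single 0 (1 : ℝ) + b • EuclideanSpace.single 1 (1 : ℝ) := by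
  ext i
  fin_cases i <;> simp [gridPt]

lemma aux_deriv (f : EuclideanSpace ℝ (Fin 2) → ℝ) (hf : ContDiff ℝ 2 f)
    (p e : EuclideanSpace ℝ (Fin 2)) (t : ℝ) :
    iteratedDeriv 2 (fun t : ℝ => f (p + t • e)) t = iteratedFDeriv ℝ 2 f (p + t • e) (fun _ => e) := by
  have h1 := (ContinuousLinearMap.toSpanSingleton ℝ e).iteratedFDeriv_comp_right
    (f := fun z => f (p + z)) (hf.comp (contDiff_const.add contDiff_id)) t (i := 2) le_rfl
  rw [iteratedDeriv_eq_iteratedFDeriv]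
  have h2 : (fun t : ℝ => f (p + t • e)) = (fun z => f (p + z)) ∘ (ContinuousLinearMap.toSpanSingleton ℝ e) := by
    ext t; simp
  rw [h2, h1, iteratedFDeriv_comp_add_left]
  simp

lemma aux_int (f : EuclideanSpace ℝ (Fin 2) → ℝ) (hf : Continuous f) (hs : HasCompactSupport f) :
    (∫ x, f x) = ∫ t, ∫ s, f (gridPt s t) := by
  have hi : Integrable f := hf.integrable_of_hasCompactSupport hs
  have mp : MeasurePreserving (fun q : ℝ × ℝ => gridPt q.1 q.2) :=
    (PiLp.volume_preserving_toLp (Fin 2)).comp (volume_preserving_finTwoArrow ℝ).symm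
  have me : MeasurableEmbedding (fun q : ℝ × ℝ => gridPt q.1 q.2) :=
    (MeasurableEquiv.toLp 2 (Fin 2 → ℝ)).measurableEmbedding.comp
      (MeasurableEquiv.finTwoArrow (α := ℝ)).symm.measurableEmbedding
  rw [← mp.integral_comp me]
  have := (mp.integrable_comp_emb me (g := f)).2 hi
  rw [Measure.volume_eq_prod] at this ⊢
  exact integral_prod_symm _ this

/-- **Lemma 3.4, Discretization Error.**
Let `f : ℝ² → ℝ` be `C²` with compact support in the ball of radius `D > 0` and
second-order partial derivatives globally bounded by `C > 0`.  Let `h > 0` with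
`n = 2D/h + 1` a positive integer, and let
`x_{ij} = ((i − (n+1)/2)h, (j − (n+1)/2)h)` for `1 ≤ i, j ≤ n`.  Then
`|∫ f − Σ_{(i,j)} f(x_{ij}) h²| ≤ C·D²·h²`. -/
theorem stmt_7
    (f : EuclideanSpace ℝ (Fin 2) → ℝ) (hf : ContDiff ℝ 2 f)
    (D : ℝ) (hD : 0 < D)
    (hsupp : ∀ x : EuclideanSpace ℝ (Fin 2), D ≤ ‖x‖ → f x = 0)
    (C : ℝ) (hC : 0 < C)
    (hC2 : ∀ (x : EuclideanSpace ℝ (Fin 2)) (i : Fin 2),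
      |iteratedFDeriv ℝ 2 f x (fun _ => EuclideanSpace.single i (1 : ℝ))| ≤ C)
    (h : ℝ) (hh : 0 < h)
    (n : ℕ) (hn : 0 < n) (hnh : (n : ℝ) = 2 * D / h + 1) :
    |(∫ x, f x) -
        ∑ p ∈ Finset.Icc 1 n ×ˢ Finset.Icc 1 n,
          f (gridPt (((p.1 : ℝ) - ((n : ℝ) + 1) / 2) * h)
                    (((p.2 : ℝ) - ((n : ℝ) + 1) / 2) * h)) * h ^ 2|
      ≤ C * D ^ 2 * h ^ 2 := by
  set x : ℕ → ℝ := fun i => ((i : ℝ) - ((n : ℝ) + 1) / 2) * h with hx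
  have hF0 : ∀ s t, (D ≤ |s| ∨ D ≤ |t|) → f (gridPt s t) = 0 := by
    intro s t hst
    apply hsupp
    rcases hst with h1 | h1
    · refine h1.trans ?_
      have := PiLp.norm_apply_le (gridPt s t) 0
      simpa [gridPt] using this
    · refine h1.trans ?_
      have := PiLp.norm_apply_le (gridPt s t) 1
      simpa [gridPt] using this
  have hs : HasCompactSupport f := by
    apply HasCompactSupport.intro (isCompact_closedBall (0 : EuclideanSpace ℝ (Fin 2)) D)
    intro y hy
    apply hsupp
    simp at hy
    exact hy.le
  have hA : ∀ t, |(∫ s, f (gridPt s t)) - ∑ i ∈ Finset.Icc 1 n, f (gridPt (x i) t) * h|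
      ≤ C * D * h ^ 2 / 6 := by
    intro t
    have hfun : (fun s => f (gridPt s t)) = fun s : ℝ =>
        f (t • EuclideanSpace.single 1 (1 : ℝ) + s • EuclideanSpace.single 0 (1 : ℝ)) := by
      ext s; rw [gridPt_eq, add_comm]
    refine aux_one (fun s => f (gridPt s t)) ?_ C D h hC hD hh ?_ (fun s hs => hF0 s t (Or.inl hs)) n hnh
    · rw [hfun]; exact hf.comp (by fun_prop)
    · intro s
      rw [hfun, aux_deriv f hf]
      exact hC2 _ 0
  have hB : ∀ s, |(∫ t, f (gridPt s t)) - ∑ j ∈ Finset.Icc 1 n, f (gridPt s (x j)) * h|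
      ≤ C * D * h ^ 2 / 6 := by
    intro s
    have hfun : (fun t => f (gridPt s t)) = fun t : ℝ =>
        f (s • EuclideanSpace.single 0 (1 : ℝ) + t • EuclideanSpace.single 1 (1 : ℝ)) := by
      ext t; rw [gridPt_eq]
    refine aux_one (fun t => f (gridPt s t)) ?_ C D h hC hD hh ?_ (fun t ht => hF0 s t (Or.inr ht)) n hnh
    · rw [hfun]; exact hf.comp (by fun_prop)
    · intro t
      rw [hfun, aux_deriv f hf]
      exact hC2 _ 1
  have hcont : Continuous (fun q : ℝ × ℝ => f (gridPt q.1 q.2)) := by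
    simp only [gridPt_eq]
    exact hf.continuous.comp (by fun_prop)
  have hcs : HasCompactSupport (fun q : ℝ × ℝ => f (gridPt q.1 q.2)) := by
    apply HasCompactSupport.intro (isCompact_Icc.prod isCompact_Icc :
      IsCompact (Set.Icc (-D) D ×ˢ Set.Icc (-D) D))
    intro q hq
    apply hF0
    by_contra hcon
    push Not at hcon
    apply hq
    rw [abs_lt, abs_lt] at hcon
    exact ⟨⟨hcon.1.1.le, hcon.1.2.le⟩, ⟨hcon.2.1.le, hcon.2.2.le⟩⟩
  have hint2 : Integrable (fun q : ℝ × ℝ => f (gridPt q.1 q.2)) ((volume : Measure ℝ).prod volume) :=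
    hcont.integrable_of_hasCompactSupport hcs
  have hI1 : Integrable (fun t => ∫ s, f (gridPt s t)) := hint2.integral_prod_right
  have hI2 : ∀ s, Integrable (fun t => f (gridPt s t)) := by
    intro s
    refine Continuous.integrable_of_hasCompactSupport
      (hcont.comp (by fun_prop : Continuous fun t : ℝ => (s, t))) ?_
    apply HasCompactSupport.intro (isCompact_Icc : IsCompact (Set.Icc (-D) D))
    intro t ht
    apply hF0
    right
    by_contra hcon
    push Not at hcon
    rw [abs_lt] at hcon
    exact ht ⟨hcon.1.le, hcon.2.le⟩
  have hI3 : Integrable (fun t => ∑ i ∈ Finset.Icc 1 n, f (gridPt (x i) t) * h) :=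
    integrable_finsetSum _ fun i _ => (hI2 (x i)).mul_const h
  have hE1 : |(∫ t, ∫ s, f (gridPt s t)) - ∫ t, ∑ i ∈ Finset.Icc 1 n, f (gridPt (x i) t) * h|
      ≤ C * D * h ^ 2 / 6 * (2 * D) := by
    rw [← integral_sub hI1 hI3]
    rw [← setIntegral_eq_integral_of_forall_compl_eq_zero (s := Set.Icc (-D) D)]
    · have := norm_setIntegral_le_of_norm_le_const (μ := volume) (s := Set.Icc (-D) D)
        (f := fun t => (∫ s, f (gridPt s t)) - ∑ i ∈ Finset.Icc 1 n, f (gridPt (x i) t) * h)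
        (C := C * D * h ^ 2 / 6) (by simp) (fun t _ => hA t)
      rw [Real.norm_eq_abs] at this
      refine this.trans_eq ?_
      rw [Real.volume_real_Icc_of_le (by linarith)]
      ring
    · intro t ht
      have ht' : D ≤ |t| := by
        by_contra hcon
        push Not at hcon
        rw [abs_lt] at hcon
        exact ht ⟨hcon.1.le, hcon.2.le⟩
      simp [hF0 _ t (Or.inr ht')]
  have hE2 : |(∫ t, ∑ i ∈ Finset.Icc 1 n, f (gridPt (x i) t) * h) -
      ∑ p ∈ Finset.Icc 1 n ×ˢ Finset.Icc 1 n, f (gridPt (x p.1) (x p.2)) * h ^ 2|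
      ≤ n * (C * D * h ^ 2 / 6 * h) := by
    rw [integral_finsetSum _ fun i _ => (hI2 (x i)).mul_const h, Finset.sum_product,
      ← Finset.sum_sub_distrib]
    refine (Finset.abs_sum_le_sum_abs _ _).trans ?_
    have : ∀ i ∈ Finset.Icc 1 n, |(∫ t, f (gridPt (x i) t) * h) -
        ∑ j ∈ Finset.Icc 1 n, f (gridPt (x i) (x j)) * h ^ 2| ≤ C * D * h ^ 2 / 6 * h := by
      intro i _
      rw [integral_mul_const]
      have e : ∑ j ∈ Finset.Icc 1 n, f (gridPt (x i) (x j)) * h ^ 2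
          = (∑ j ∈ Finset.Icc 1 n, f (gridPt (x i) (x j)) * h) * h := by
        rw [Finset.sum_mul]; exact Finset.sum_congr rfl fun j _ => by ring
      rw [e, ← sub_mul, abs_mul, abs_of_pos hh]
      exact mul_le_mul_of_nonneg_right (hB (x i)) hh.le
    refine (Finset.sum_le_sum this).trans_eq ?_
    simp
  have hnh' : n * h = 2 * D + h := by rw [hnh]; field_simp
  have hh2 : h ≤ 2 * D := by
    have hpos : 0 < 2 * D / h := by positivity
    have : (1 : ℝ) < n := by linarith
    have : 1 < n := by exact_mod_cast this
    have : (2 : ℝ) ≤ n := by exact_mod_cast this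
    nlinarith
  rw [aux_int f hf.continuous hs]
  refine (abs_sub_le _ _ _).trans ((add_le_add hE1 hE2).trans ?_)
  have : (n : ℝ) * (C * D * h ^ 2 / 6 * h) = C * D * h ^ 2 / 6 * (2 * D + h) := by
    rw [← hnh']; ring
  rw [this, ← mul_add]
  have hk : 0 ≤ C * D * h ^ 2 / 6 := by positivity
  nlinarith [mul_le_mul_of_nonneg_left hh2 hk]
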